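/- Let G be a symmetric finite discounted stochastic game, ε ≥ 0, and let Π = ∏_{i∈N} Π^i where each Π^i ⊂ Δ^i is a finite set of policies with Π^i = Π^j for all i, j ∈ N, and suppose Π ∩ Δ^ε_eq ≠ ∅. Then for every π_0 ∈ Π there exists a finite ε-revision path π_0, π_1, …, π_L lying entirely in Π, with L ≤ N, such that π_L ∈ Π ∩ Δ^ε_eq. -/

import Mathlib

open scoped BigOperators

/-- A finite discounted stochastic game: finite player set `N`, finite state space `X`,
finite action sets `U i`, stage costs `c`, discount factors `β i ∈ [0,1)`, and a
transition kernel `P`. -/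
structure StochGame (N X : Type) (U : N → Type) [Fintype N] [DecidableEq N] [Fintype X]
    [∀ i, Fintype (U i)] : Type where
  c : N → X → (∀ j, U j) → ℝ
  β : N → ℝ
  β_nonneg : ∀ i, 0 ≤ β i
  β_lt_one : ∀ i, β i < 1
  P : X → (∀ j, U j) → X → ℝ
  P_nonneg : ∀ x a x', 0 ≤ P x a x'
  P_sum : ∀ x a, ∑ x', P x a x' = 1

/-- `γ` is a stationary policy: a stochastic kernel on actions given states. -/
def IsPol {X A : Type} [Fintype A] (γ : X → A → ℝ) : Prop :=
  (∀ x a, 0 ≤ γ x a) ∧ ∀ x, ∑ a, γ x a = 1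

section Game

variable {N X : Type} {U : N → Type} [Fintype N] [DecidableEq N] [Fintype X] [DecidableEq X]
  [∀ i, Fintype (U i)]

/-- A joint stationary policy: one stationary policy per player. -/
def IsJointPol (γ : ∀ i, X → U i → ℝ) : Prop := ∀ i, IsPol (γ i)

/-- Probability that joint action `a` is selected at state `x` (players randomize
independently). -/
def jointProb (γ : ∀ i, X → U i → ℝ) (x : X) (a : ∀ i, U i) : ℝ := ∏ i, γ i x (a i)

/-- Distribution of the state at time `t`, starting from `x0`, under joint policy `γ`. -/
noncomputable def stateDist (G : StochGame N X U) (γ : ∀ i, X → U i → ℝ) (x0 : X) :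
    ℕ → X → ℝ
  | 0, x => if x = x0 then 1 else 0
  | (t+1), x' => ∑ x, stateDist G γ x0 t x * ∑ a : ∀ i, U i, jointProb γ x a * G.P x a x'

/-- Expected stage cost of player `i` at time `t`, starting from `x0`, under `γ`. -/
noncomputable def expCost (G : StochGame N X U) (γ : ∀ i, X → U i → ℝ) (i : N) (x0 : X)
    (t : ℕ) : ℝ :=
  ∑ x, stateDist G γ x0 t x * ∑ a : ∀ j, U j, jointProb γ x a * G.c i x a

/-- `Jval G i x γ` is player `i`'s expected discounted cost from initial state `x`
under the joint stationary policy `γ`. -/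
noncomputable def Jval (G : StochGame N X U) (i : N) (x : X) (γ : ∀ j, X → U j → ℝ) : ℝ :=
  ∑' t : ℕ, (G.β i) ^ t * expCost G γ i x t

/-- `γ i` is an `ε`-best-response of player `i` to the policies `γ j`, `j ≠ i`, of the
remaining players. -/
def IsEpsBR (G : StochGame N X U) (ε : ℝ) (i : N) (γ : ∀ j, X → U j → ℝ) : Prop :=
  ∀ x, Jval G i x γ ≤
    (⨅ π : {f : X → U i → ℝ // IsPol f}, Jval G i x (Function.update γ i π.1)) + ε

/-- `γ` is an `ε`-equilibrium: every player is `ε`-best-responding. -/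
def IsEpsEq (G : StochGame N X U) (ε : ℝ) (γ : ∀ j, X → U j → ℝ) : Prop :=
  ∀ i, IsEpsBR G ε i γ

/-- `(path 0, …, path L)` is an `ε`-revision path: a player that is `ε`-best-responding
does not revise its policy at the next step. -/
def IsRevisionPath (G : StochGame N X U) (ε : ℝ) (L : ℕ)
    (path : ℕ → ∀ i, X → U i → ℝ) : Prop :=
  ∀ k < L, ∀ i, IsEpsBR G ε i (path k) → path (k+1) i = path k i

end Game

/-- A stochastic game with common action set `A` is symmetric: common discount factors,
and permuting the players' actions permutes the costs and leaves transitions unchanged. -/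
def IsSymmetricGame {N X A : Type} [Fintype N] [DecidableEq N] [Fintype X] [Fintype A]
    (G : StochGame N X (fun _ : N => A)) : Prop :=
  (∀ i j, G.β i = G.β j) ∧
  ∀ (σ : Equiv.Perm N) (i : N) (x : X) (a : N → A),
    G.c i x (fun j => a (σ j)) = G.c (σ i) x a ∧
    ∀ x', G.P x a x' = G.P x (fun j => a (σ j)) x'

section SymmetricGame

variable {N X A : Type} [Fintype N]

theorem jointProb_comp_perm (γ : N → X → A → ℝ) (σ : Equiv.Perm N) (x : X) (a : N → A) :
    jointProb (U := fun _ : N => A) (fun j => γ (σ j)) x (fun j => a (σ j)) =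
      jointProb (U := fun _ : N => A) γ x a :=
  Equiv.prod_comp σ fun j => γ j x (a j)

variable [DecidableEq N] [Fintype A]

/-- Permuting the policies and the integrand simultaneously leaves the expectation over
joint actions unchanged. -/
theorem sum_jointProb_comp_perm (γ : N → X → A → ℝ) (σ : Equiv.Perm N) (x : X)
    (f g : (N → A) → ℝ) (hfg : ∀ a, f (fun j => a (σ j)) = g a) :
    ∑ a, jointProb (U := fun _ : N => A) (fun j => γ (σ j)) x a * f a =
      ∑ a, jointProb (U := fun _ : N => A) γ x a * g a := by
  rw [← Equiv.sum_comp (Equiv.arrowCongr σ.symm (Equiv.refl A))]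
  refine Finset.sum_congr rfl fun a _ => ?_
  rw [← hfg, ← jointProb_comp_perm γ σ]
  rfl

variable [Fintype X] [DecidableEq X] {G : StochGame N X (fun _ : N => A)}

theorem IsSymmetricGame.stateDist_comp_perm (hG : IsSymmetricGame G) (γ : N → X → A → ℝ)
    (σ : Equiv.Perm N) (x0 : X) (t : ℕ) (x : X) :
    stateDist G (fun j => γ (σ j)) x0 t x = stateDist G γ x0 t x := by
  induction t generalizing x with
  | zero => rfl
  | succ t ih =>
    simp only [stateDist, ih]
    refine Finset.sum_congr rfl fun y _ => ?_
    rw [sum_jointProb_comp_perm γ σ y (fun a => G.P y a x) (fun a => G.P y a x) fun a => ?_]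
    cases isEmpty_or_nonempty N with
    | inl _ => exact congrArg (G.P y · x) (Subsingleton.elim _ _)
    | inr h => exact ((hG.2 σ h.some y a).2 x).symm

theorem IsSymmetricGame.expCost_comp_perm (hG : IsSymmetricGame G) (γ : N → X → A → ℝ)
    (σ : Equiv.Perm N) (i : N) (x0 : X) (t : ℕ) :
    expCost G (fun j => γ (σ j)) i x0 t = expCost G γ (σ i) x0 t := by
  refine Finset.sum_congr rfl fun x _ => ?_
  rw [hG.stateDist_comp_perm,
    sum_jointProb_comp_perm γ σ x (G.c i x) (G.c (σ i) x) fun a => (hG.2 σ i x a).1]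

/-- In a symmetric game, relabelling the policies relabels the costs. -/
theorem IsSymmetricGame.Jval_comp_perm (hG : IsSymmetricGame G) (γ : N → X → A → ℝ)
    (σ : Equiv.Perm N) (i : N) (x : X) :
    Jval G i x (fun j => γ (σ j)) = Jval G (σ i) x γ := by
  simp only [Jval, hG.1 i (σ i), hG.expCost_comp_perm]

/-- In a symmetric game, players using the same policy are either all `ε`-best-responding
or all not. -/
theorem IsSymmetricGame.isEpsBR_of_eq (hG : IsSymmetricGame G) {ε : ℝ} {γ : N → X → A → ℝ}
    {i j : N} (hij : γ i = γ j) (h : IsEpsBR G ε i γ) : IsEpsBR G ε j γ := by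
  intro x
  have key : ∀ f : X → A → ℝ,
      Jval G i x (Function.update γ i f) = Jval G j x (Function.update γ j f) := by
    intro f
    have hswap : Function.update γ i f =
        fun k => Function.update γ j f (Equiv.swap i j k) := by
      funext k
      by_cases hki : k = i
      · simp [hki]
      · by_cases hkj : k = j
        · subst hkj
          by_cases hik : i = k
          · exact absurd hik.symm hki
          · simp [Function.update_of_ne hki, Function.update_of_ne hik, hij]
        · simp [Equiv.swap_apply_of_ne_of_ne hki hkj, Function.update_of_ne hki,
            Function.update_of_ne hkj]
    rw [hswap, hG.Jval_comp_perm, Equiv.swap_apply_left]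
  have hself : Jval G i x γ = Jval G j x γ := by
    have := key (γ i)
    rwa [Function.update_eq_self, hij, Function.update_eq_self] at this
  have hx := h x
  simp only [key, hself] at hx
  exact hx

open Classical in
/-- From any joint policy in `Pi0`, an `ε`-equilibrium in `Pi0` is reached along an
`ε`-revision path whose length is at most the number of distinct policies in use. -/
theorem IsSymmetricGame.exists_revisionPath (hG : IsSymmetricGame G) {ε : ℝ}
    {Pi0 : Set (X → A → ℝ)} {π : N → X → A → ℝ} (hπ : ∀ i, π i ∈ Pi0) (heq : IsEpsEq G ε π)
    (d : ℕ) (γ : N → X → A → ℝ) (hγ : ∀ i, γ i ∈ Pi0) (hd : (Finset.univ.image γ).card ≤ d) :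
    ∃ (L : ℕ) (path : ℕ → N → X → A → ℝ), L ≤ d ∧ path 0 = γ ∧
      (∀ k ≤ L, ∀ i, path k i ∈ Pi0) ∧ IsRevisionPath G ε L path ∧ IsEpsEq G ε (path L) := by
  induction d generalizing γ with
  | zero =>
    have hN : IsEmpty N := by simpa [Finset.univ_eq_empty_iff] using hd
    exact ⟨0, fun _ => γ, le_rfl, rfl, fun _ _ => hγ, fun k hk => absurd hk (Nat.not_lt_zero k),
      fun i => isEmptyElim i⟩
  | succ d ih =>
    by_cases hall : IsEpsEq G ε γ
    · exact ⟨0, fun _ => γ, Nat.zero_le _, rfl, fun _ _ => hγ,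
        fun k hk => absurd hk (Nat.not_lt_zero k), hall⟩
    by_cases hnone : ∀ i, ¬ IsEpsBR G ε i γ
    · refine ⟨1, fun k => if k = 0 then γ else π, by omega, rfl, ?_, ?_, by simpa using heq⟩
      · intro k _ i
        dsimp only
        split_ifs
        exacts [hγ i, hπ i]
      · intro k hk i hi
        obtain rfl : k = 0 := by omega
        exact absurd hi (hnone i)
    push Not at hnone
    obtain ⟨i, hi⟩ := hnone
    obtain ⟨j, hj⟩ : ∃ j, ¬ IsEpsBR G ε j γ := by simpa [IsEpsEq] using hall
    let γ' : N → X → A → ℝ := fun k => if IsEpsBR G ε k γ then γ k else γ i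
    have hγ' : ∀ k, ∃ l, IsEpsBR G ε l γ ∧ γ' k = γ l := by
      intro k
      by_cases hk : IsEpsBR G ε k γ
      · exact ⟨k, hk, if_pos hk⟩
      · exact ⟨i, hi, if_neg hk⟩
    have hcard : (Finset.univ.image γ').card < (Finset.univ.image γ).card := by
      refine Finset.card_lt_card ((Finset.ssubset_iff_of_subset ?_).2 ⟨γ j, by simp, ?_⟩)
      · intro f hf
        obtain ⟨k, -, rfl⟩ := Finset.mem_image.1 hf
        obtain ⟨l, -, hl⟩ := hγ' k
        exact Finset.mem_image.2 ⟨l, Finset.mem_univ l, hl.symm⟩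
      · intro hf
        obtain ⟨k, -, hk⟩ := Finset.mem_image.1 hf
        obtain ⟨l, hl, hkl⟩ := hγ' k
        exact hj (hG.isEpsBR_of_eq (hkl.symm.trans hk) hl)
    obtain ⟨L, path, hL, h0, hmem, hrev, hend⟩ := ih γ' (fun k => by
      obtain ⟨l, -, hl⟩ := hγ' k
      exact hl ▸ hγ l) (by omega)
    refine ⟨L + 1, fun k => Nat.casesOn k γ path, by omega, rfl, ?_, ?_, hend⟩
    · rintro (_ | k) hk
      exacts [hγ, hmem k (by omega)]
    · rintro (_ | k) hk l hl
      · change path 0 l = γ l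
        rw [h0]
        exact if_pos hl
      · exact hrev k (by omega) l hl

end SymmetricGame

/-- in a symmetric game, if `Π = ∏ᵢ Π⁰` (the same finite set of
policies `Π⁰` for every player) contains an `ε`-equilibrium, then from any `π0 ∈ Π`
there is an `ε`-revision path lying in `Π`, of length `L ≤ N`, ending at an
`ε`-equilibrium in `Π`. -/
theorem stmt3 {N X A : Type} [Fintype N] [DecidableEq N] [Fintype X] [DecidableEq X]
    [Fintype A]
    (G : StochGame N X (fun _ : N => A)) (hG : IsSymmetricGame G)
    (ε : ℝ) (hε : 0 ≤ ε)
    (Pi0 : Set (X → A → ℝ)) (hfin : Pi0.Finite) (hpol : ∀ f ∈ Pi0, IsPol f)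
    (heq : ∃ π : ∀ _ : N, X → A → ℝ, (∀ i, π i ∈ Pi0) ∧ IsEpsEq G ε π)
    (π0 : ∀ _ : N, X → A → ℝ) (hπ0 : ∀ i, π0 i ∈ Pi0) :
    ∃ (L : ℕ) (path : ℕ → ∀ _ : N, X → A → ℝ),
      L ≤ Fintype.card N ∧ path 0 = π0 ∧
      (∀ k ≤ L, ∀ i, path k i ∈ Pi0) ∧
      IsRevisionPath G ε L path ∧ IsEpsEq G ε (path L) := by
  classical
  obtain ⟨π, hπ, hπeq⟩ := heq
  exact hG.exists_revisionPath hπ hπeq _ π0 hπ0 (Finset.card_image_le.trans_eq Finset.card_univ)
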